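/- Let n ≥ 2 be an integer. Then the function D ↦ D²·λ̄₁(n,D) is strictly decreasing on (0, π): if 0 < D₁ < D₂ < π then D₁²·λ̄₁(n,D₁) > D₂²·λ̄₁(n,D₂). -/

import Mathlib

open Real Set

noncomputable section

/-- Rayleigh quotient of the one-dimensional model operator
`d²/ds² − (n−1)·tan(s)·d/ds` on `[−D/2, D/2]` with weight `cos^{n−1}(s)`. -/
def rayleighQ (n : ℕ) (D : ℝ) (φ : ℝ → ℝ) : ℝ :=
  (∫ s in (-(D/2))..(D/2), deriv φ s ^ 2 * Real.cos s ^ (n-1)) /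
  (∫ s in (-(D/2))..(D/2), φ s ^ 2 * Real.cos s ^ (n-1))

/-- The first model eigenvalue `λ̄₁(n,D)`: infimum of the Rayleigh quotient over
nonzero C¹ functions on `[−D/2, D/2]` vanishing at the endpoints. -/
def modelLam1 (n : ℕ) (D : ℝ) : ℝ :=
  sInf (rayleighQ n D '' {φ : ℝ → ℝ | ContDiffOn ℝ 1 φ (Set.Icc (-(D/2)) (D/2)) ∧
    (∃ s ∈ Set.Icc (-(D/2)) (D/2), φ s ≠ 0) ∧ φ (-(D/2)) = 0 ∧ φ (D/2) = 0})

/-- The second model eigenvalue `λ̄₂(n,D)`: the same infimum restricted to odd functions. -/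
def modelLam2 (n : ℕ) (D : ℝ) : ℝ :=
  sInf (rayleighQ n D '' {φ : ℝ → ℝ | ContDiffOn ℝ 1 φ (Set.Icc (-(D/2)) (D/2)) ∧
    (∃ s ∈ Set.Icc (-(D/2)) (D/2), φ s ≠ 0) ∧
    (∀ s ∈ Set.Icc (-(D/2)) (D/2), φ (-s) = -φ s) ∧ φ (-(D/2)) = 0 ∧ φ (D/2) = 0})

/-- Iterates `T^j 1` of the Volterra operator `T f s = ∫₀ˢ p(t)⁻¹ ∫₀ᵗ p f`. -/
def volterraIter (p : ℝ → ℝ) : ℕ → ℝ → ℝ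
  | 0 => fun _ => 1
  | j + 1 => fun s => ∫ t in (0 : ℝ)..s, (∫ r in (0 : ℝ)..t, p r * volterraIter p j r) / p t

/-- The momentum `p (T^(j+1) 1)'` of the Volterra iterates. -/
def volterraFlux (p : ℝ → ℝ) (j : ℕ) (t : ℝ) : ℝ :=
  ∫ r in (0 : ℝ)..t, p r * volterraIter p j r

/-- The even solution of `(p φ')' = -μ p φ` with `φ 0 = 1`. -/
def evenSol (p : ℝ → ℝ) (μ s : ℝ) : ℝ := ∑' j, (-μ) ^ j * volterraIter p j s

/-- `-μ⁻¹ p φ'` for the solution `φ = evenSol p μ`. -/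
def evenSolFlux (p : ℝ → ℝ) (μ s : ℝ) : ℝ := ∑' j, (-μ) ^ j * volterraFlux p j s

section Volterra

variable {p : ℝ → ℝ} {c : ℝ}

lemma volterraIter_succ (j : ℕ) (s : ℝ) :
    volterraIter p (j + 1) s = ∫ t in (0 : ℝ)..s, volterraFlux p j t / p t := rfl

lemma continuous_volterraFlux_of (hp : Continuous p) {j : ℕ}
    (h : Continuous (volterraIter p j)) : Continuous (volterraFlux p j) :=
  intervalIntegral.continuous_primitive (fun _ _ => (hp.mul h).intervalIntegrable _ _) 0

lemma continuous_volterraIter (hp : Continuous p) (hp0 : ∀ s, p s ≠ 0) (j : ℕ) :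
    Continuous (volterraIter p j) := by
  induction j with
  | zero => exact continuous_const
  | succ j ih =>
    exact intervalIntegral.continuous_primitive
      (fun _ _ => ((continuous_volterraFlux_of hp ih).div hp hp0).intervalIntegrable _ _) 0

lemma continuous_volterraFlux (hp : Continuous p) (hp0 : ∀ s, p s ≠ 0) (j : ℕ) :
    Continuous (volterraFlux p j) :=
  continuous_volterraFlux_of hp (continuous_volterraIter hp hp0 j)

lemma hasDerivAt_volterraFlux (hp : Continuous p) (hp0 : ∀ s, p s ≠ 0) (j : ℕ) (s : ℝ) :
    HasDerivAt (volterraFlux p j) (p s * volterraIter p j s) s :=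
  (hp.mul (continuous_volterraIter hp hp0 j)).integral_hasStrictDerivAt 0 s |>.hasDerivAt

lemma hasDerivAt_volterraIter_succ (hp : Continuous p) (hp0 : ∀ s, p s ≠ 0) (j : ℕ) (s : ℝ) :
    HasDerivAt (volterraIter p (j + 1)) (volterraFlux p j s / p s) s :=
  ((continuous_volterraFlux hp hp0 j).div hp hp0).integral_hasStrictDerivAt 0 s |>.hasDerivAt

lemma volterraFlux_neg_of (he : ∀ s, p (-s) = p s) {j : ℕ}
    (h : ∀ s, volterraIter p j (-s) = volterraIter p j s) (s : ℝ) :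
    volterraFlux p j (-s) = -volterraFlux p j s := by
  have := intervalIntegral.integral_comp_neg (a := 0) (b := s)
    (fun r => p r * volterraIter p j r)
  simp only [he, h, neg_zero] at this
  rw [volterraFlux, volterraFlux, this, intervalIntegral.integral_symm]

lemma volterraIter_neg (he : ∀ s, p (-s) = p s) (j : ℕ) (s : ℝ) :
    volterraIter p j (-s) = volterraIter p j s := by
  induction j generalizing s with
  | zero => rfl
  | succ j ih =>
    have := intervalIntegral.integral_comp_neg (a := 0) (b := s)
      (fun r => volterraFlux p j r / p r)
    simp only [he, volterraFlux_neg_of he ih, neg_zero, neg_div,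
      intervalIntegral.integral_neg] at this
    rw [volterraIter_succ, volterraIter_succ, intervalIntegral.integral_symm, ← this, neg_neg]

lemma abs_volterraFlux_le_of (hc : 0 < c) (hcp : ∀ s, c ≤ p s) (hp1 : ∀ s, p s ≤ 1) {j : ℕ}
    (h : ∀ s, |volterraIter p j s| ≤ (s ^ 2 / c) ^ j / j.factorial) (s : ℝ) :
    |volterraFlux p j s| ≤ (s ^ 2 / c) ^ j / j.factorial * |s| := by
  have := intervalIntegral.norm_integral_le_of_norm_le_const (a := 0) (b := s)
    (f := fun r => p r * volterraIter p j r) (C := (s ^ 2 / c) ^ j / j.factorial) ?_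
  · simpa [volterraFlux] using this
  · intro r hr
    have hrs : r ^ 2 ≤ s ^ 2 := by
      rcases Set.mem_uIoc.1 hr with h | h <;> nlinarith
    rw [norm_mul, Real.norm_of_nonneg (hc.le.trans (hcp r)), Real.norm_eq_abs]
    calc p r * |volterraIter p j r| ≤ 1 * |volterraIter p j r| := by gcongr; exact hp1 r
      _ ≤ (r ^ 2 / c) ^ j / j.factorial := by rw [one_mul]; exact h r
      _ ≤ _ := by gcongr

lemma abs_volterraIter_le (hc : 0 < c) (hcp : ∀ s, c ≤ p s)
    (hp1 : ∀ s, p s ≤ 1) (he : ∀ s, p (-s) = p s) (j : ℕ) (s : ℝ) :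
    |volterraIter p j s| ≤ (s ^ 2 / c) ^ j / j.factorial := by
  induction j generalizing s with
  | zero => simp [volterraIter]
  | succ j ih =>
    wlog hs : 0 ≤ s generalizing s
    · simpa [volterraIter_neg he] using this (-s) (by linarith)
    have key : ∀ t, t ∈ Set.Ioc 0 s → ‖volterraFlux p j t / p t‖ ≤
        (c⁻¹ ^ (j + 1) / j.factorial) * t ^ (2 * j + 1) := by
      intro t ht
      rw [norm_div, Real.norm_of_nonneg (hc.le.trans (hcp t)), Real.norm_eq_abs]
      have h1 := abs_volterraFlux_le_of hc hcp hp1 ih t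
      rw [abs_of_pos ht.1] at h1
      calc |volterraFlux p j t| / p t ≤ ((t ^ 2 / c) ^ j / j.factorial * t) / c := by
            have := ht.1
            gcongr
            exact hcp t
        _ = _ := by rw [div_pow, ← pow_mul, inv_pow]; field_simp; ring
    have := intervalIntegral.norm_integral_le_of_norm_le (f := fun t => volterraFlux p j t / p t)
      (g := fun t => (c⁻¹ ^ (j + 1) / j.factorial) * t ^ (2 * j + 1)) (μ := MeasureTheory.volume)
      hs (Filter.Eventually.of_forall key) (Continuous.intervalIntegrable (by fun_prop) _ _)
    rw [intervalIntegral.integral_const_mul, integral_pow] at this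
    rw [volterraIter_succ]
    refine this.trans ?_
    rw [Nat.factorial_succ, div_pow, ← pow_mul, inv_pow]
    push_cast
    have hf : (0 : ℝ) < j.factorial := by positivity
    have e : (s ^ (2 * j + 1 + 1) - 0 ^ (2 * j + 1 + 1)) = s ^ (2 * (j + 1)) := by
      rw [zero_pow (by omega)]; ring_nf
    rw [e]
    calc _ = s ^ (2 * (j + 1)) / c ^ (j + 1) / ((2 * j + 1 + 1) * j.factorial) := by field_simp
      _ ≤ _ := by gcongr; linarith [(Nat.cast_nonneg j : (0:ℝ) ≤ j)]

lemma abs_volterraFlux_le (hc : 0 < c) (hcp : ∀ s, c ≤ p s)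
    (hp1 : ∀ s, p s ≤ 1) (he : ∀ s, p (-s) = p s) (j : ℕ) (s : ℝ) :
    |volterraFlux p j s| ≤ (s ^ 2 / c) ^ j / j.factorial * |s| :=
  abs_volterraFlux_le_of hc hcp hp1 (abs_volterraIter_le hc hcp hp1 he j) s

lemma abs_evenSol_term_le (hc : 0 < c) (hcp : ∀ s, c ≤ p s)
    (hp1 : ∀ s, p s ≤ 1) (he : ∀ s, p (-s) = p s) {μ s L S : ℝ} (hμ : |μ| ≤ L) (hs : |s| ≤ S)
    (j : ℕ) : ‖(-μ) ^ j * volterraIter p j s‖ ≤ (L * (S ^ 2 / c)) ^ j / j.factorial := by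
  rw [norm_mul, norm_pow, norm_neg, Real.norm_eq_abs, Real.norm_eq_abs, mul_pow, mul_div_assoc]
  have := abs_volterraIter_le hc hcp hp1 he j s
  have hL : 0 ≤ L := (abs_nonneg μ).trans hμ
  have h2 : s ^ 2 ≤ S ^ 2 := sq_le_sq' (by linarith [neg_abs_le s]) ((le_abs_self s).trans hs)
  gcongr
  exact this.trans (by gcongr)

lemma abs_evenSolFlux_term_le (hc : 0 < c) (hcp : ∀ s, c ≤ p s)
    (hp1 : ∀ s, p s ≤ 1) (he : ∀ s, p (-s) = p s) {μ s L S : ℝ} (hμ : |μ| ≤ L) (hs : |s| ≤ S)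
    (j : ℕ) : ‖(-μ) ^ j * volterraFlux p j s‖ ≤ (L * (S ^ 2 / c)) ^ j / j.factorial * S := by
  rw [norm_mul, norm_pow, norm_neg, Real.norm_eq_abs, Real.norm_eq_abs, mul_pow, mul_div_assoc,
    mul_assoc]
  have := abs_volterraFlux_le hc hcp hp1 he j s
  have hL : 0 ≤ L := (abs_nonneg μ).trans hμ
  have h2 : s ^ 2 ≤ S ^ 2 := sq_le_sq' (by linarith [neg_abs_le s]) ((le_abs_self s).trans hs)
  gcongr
  exact this.trans (by gcongr)

lemma continuous_evenSol (hp : Continuous p) (hc : 0 < c) (hcp : ∀ s, c ≤ p s)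
    (hp1 : ∀ s, p s ≤ 1) (he : ∀ s, p (-s) = p s) :
    Continuous fun x : ℝ × ℝ => evenSol p x.1 x.2 := by
  rw [continuous_iff_continuousAt]
  intro x
  have hp0 : ∀ s, p s ≠ 0 := fun s => (hc.trans_le (hcp s)).ne'
  have hU : {y : ℝ × ℝ | |y.1| < |x.1| + 1 ∧ |y.2| < |x.2| + 1} ∈ nhds x := by
    refine IsOpen.mem_nhds ?_ (by simp)
    exact (isOpen_lt continuous_fst.abs continuous_const).inter
      (isOpen_lt continuous_snd.abs continuous_const)
  refine ContinuousOn.continuousAt ?_ hU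
  refine continuousOn_tsum (u := fun j : ℕ =>
    ((|x.1| + 1) * ((|x.2| + 1) ^ 2 / c)) ^ j / j.factorial) ?_
    (Real.summable_pow_div_factorial _) ?_
  · intro j
    have := continuous_volterraIter hp hp0 j
    fun_prop
  · intro j y hy
    exact abs_evenSol_term_le hc hcp hp1 he hy.1.le hy.2.le j

lemma hasDerivAt_evenSol (hp : Continuous p) (hc : 0 < c) (hcp : ∀ s, c ≤ p s)
    (hp1 : ∀ s, p s ≤ 1) (he : ∀ s, p (-s) = p s) (μ s : ℝ) :
    HasDerivAt (evenSol p μ) (-μ * evenSolFlux p μ s / p s) s := by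
  have hp0 : ∀ s, p s ≠ 0 := fun s => (hc.trans_le (hcp s)).ne'
  have hsum : ∀ s, Summable fun j => (-μ) ^ j * volterraIter p j s := fun s =>
    (Real.summable_pow_div_factorial _).of_norm_bounded
      (abs_evenSol_term_le hc hcp hp1 he (le_refl |μ|) (le_refl |s|))
  have hE : evenSol p μ = fun s => 1 + ∑' j, (-μ) ^ (j + 1) * volterraIter p (j + 1) s := by
    ext s
    rw [evenSol, (hsum s).tsum_eq_zero_add]
    simp [volterraIter]
  have hF : -μ * evenSolFlux p μ s / p s
      = ∑' j, (-μ) ^ (j + 1) * (volterraFlux p j s / p s) := by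
    rw [evenSolFlux, ← tsum_mul_left, ← tsum_div_const]
    congr 1; ext j; ring
  rw [hE, hF]
  refine HasDerivAt.const_add _ ?_
  refine hasDerivAt_tsum_of_isPreconnected (t := Set.Ioo (-(|s| + 1)) (|s| + 1)) (y₀ := 0)
    (u := fun j : ℕ => |μ| * ((|μ| * ((|s| + 1) ^ 2 / c)) ^ j / j.factorial * (|s| + 1)) / c)
    ?_ isOpen_Ioo isPreconnected_Ioo
    (fun j y _ => (hasDerivAt_volterraIter_succ hp hp0 j y).const_mul _) ?_ ?_ ?_ ?_
  · exact (((Real.summable_pow_div_factorial _).mul_right _).mul_left _).div_const _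
  · intro j y hy
    have h1 := abs_evenSolFlux_term_le hc hcp hp1 he (le_refl |μ|) (abs_lt.2 hy).le j
    rw [show (-μ) ^ (j + 1) * (volterraFlux p j y / p y)
      = (-μ) * ((-μ) ^ j * volterraFlux p j y) / p y by ring, norm_div, norm_mul, norm_neg,
      Real.norm_of_nonneg (hc.le.trans (hcp y)), Real.norm_eq_abs]
    gcongr
    exact hcp y
  · constructor <;> linarith [abs_nonneg s]
  · exact (summable_nat_add_iff 1).2 (hsum 0)
  · exact abs_lt.1 (lt_add_one _)

lemma hasDerivAt_evenSolFlux (hp : Continuous p) (hc : 0 < c) (hcp : ∀ s, c ≤ p s)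
    (hp1 : ∀ s, p s ≤ 1) (he : ∀ s, p (-s) = p s) (μ s : ℝ) :
    HasDerivAt (evenSolFlux p μ) (p s * evenSol p μ s) s := by
  have hp0 : ∀ s, p s ≠ 0 := fun s => (hc.trans_le (hcp s)).ne'
  have hF : p s * evenSol p μ s = ∑' j, (-μ) ^ j * (p s * volterraIter p j s) := by
    rw [evenSol, ← tsum_mul_left]
    congr 1; ext j; ring
  rw [hF]
  refine hasDerivAt_tsum_of_isPreconnected (t := Set.Ioo (-(|s| + 1)) (|s| + 1)) (y₀ := 0)
    (u := fun j : ℕ => (|μ| * ((|s| + 1) ^ 2 / c)) ^ j / j.factorial)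
    (Real.summable_pow_div_factorial _) isOpen_Ioo isPreconnected_Ioo
    (fun j y _ => (hasDerivAt_volterraFlux hp hp0 j y).const_mul _) ?_ ?_ ?_ ?_
  · intro j y hy
    have h1 := abs_evenSol_term_le hc hcp hp1 he (le_refl |μ|) (abs_lt.2 hy).le j
    rw [show (-μ) ^ j * (p y * volterraIter p j y)
      = p y * ((-μ) ^ j * volterraIter p j y) by ring, norm_mul,
      Real.norm_of_nonneg (hc.le.trans (hcp y))]
    exact (mul_le_of_le_one_left (norm_nonneg _) (hp1 y)).trans h1
  · constructor <;> linarith [abs_nonneg s]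
  · simp [volterraFlux, summable_zero]
  · exact abs_lt.1 (lt_add_one _)

lemma evenSol_neg (he : ∀ s, p (-s) = p s) (μ s : ℝ) : evenSol p μ (-s) = evenSol p μ s := by
  simp only [evenSol, volterraIter_neg he]

lemma evenSol_apply_zero (μ : ℝ) : evenSol p μ 0 = 1 := by
  rw [evenSol, tsum_eq_single 0]
  · simp [volterraIter]
  · rintro (_ | j) hj
    · exact absurd rfl hj
    · simp [volterraIter]

lemma evenSol_zero_left (s : ℝ) : evenSol p 0 s = 1 := by
  rw [evenSol, tsum_eq_single 0]
  · simp [volterraIter]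
  · intro j hj
    simp [hj]

lemma evenSolFlux_apply_zero (μ : ℝ) : evenSolFlux p μ 0 = 0 := by
  simp [evenSolFlux, volterraFlux]

end Volterra

section Sturm

lemma cos_pos_of_mem_Icc {R s : ℝ} (hR : R < π / 2) (hs : s ∈ Icc (-R) R) : 0 < cos s :=
  cos_pos_of_mem_Ioo ⟨by linarith [hs.1], by linarith [hs.2]⟩

lemma hasDerivAt_cos_pow (k : ℕ) {s : ℝ} (hs : cos s ≠ 0) :
    HasDerivAt (fun s => cos s ^ k) (-(k * tan s * cos s ^ k)) s := by
  refine ((hasDerivAt_cos s).pow k).congr_deriv ?_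
  rcases k with _ | k
  · simp
  · rw [tan_eq_sin_div_cos, pow_succ, Nat.add_sub_cancel]
    field_simp

lemma integrableOn_deriv_sq_mul {a b : ℝ} (hab : a < b) {ψ w : ℝ → ℝ}
    (hψ : ContDiffOn ℝ 1 ψ (Icc a b)) (hw : Continuous w) :
    MeasureTheory.IntegrableOn (fun s => deriv ψ s ^ 2 * w s) (Icc a b) := by
  have h1 : ContinuousOn (fun s => derivWithin ψ (Icc a b) s ^ 2 * w s) (Icc a b) :=
    ((hψ.continuousOn_derivWithin (uniqueDiffOn_Icc hab) le_rfl).pow 2).mul hw.continuousOn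
  have h2 := h1.integrableOn_Icc (μ := MeasureTheory.volume)
  rw [integrableOn_Icc_iff_integrableOn_Ioo] at h2 ⊢
  refine h2.congr_fun (fun s hs => ?_) measurableSet_Ioo
  simp only [derivWithin_of_mem_nhds (Icc_mem_nhds hs.1 hs.2)]

/-- Jacobi's inequality: a positive solution of the model equation bounds the Rayleigh quotient
from below. -/
lemma mul_integral_sq_le_of_pos_solution (k : ℕ) {R μ : ℝ} (h0 : 0 < R) (hR : R < π / 2)
    {φ v : ℝ → ℝ} (hφ : ∀ s, HasDerivAt φ (v s) s) (hv : Continuous v)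
    (hv' : ∀ s ∈ Ioo (-R) R, HasDerivAt v (k * tan s * v s - μ * φ s) s)
    (hpos : ∀ s ∈ Icc (-R) R, 0 < φ s) {ψ : ℝ → ℝ} (hψ : ContDiffOn ℝ 1 ψ (Icc (-R) R))
    (hψl : ψ (-R) = 0) (hψr : ψ R = 0) :
    μ * ∫ s in (-R)..R, ψ s ^ 2 * cos s ^ k ≤ ∫ s in (-R)..R, deriv ψ s ^ 2 * cos s ^ k := by
  have hlt : -R < R := by linarith
  have hφc : Continuous φ := continuous_iff_continuousAt.2 fun s => (hφ s).continuousAt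
  have hi1 := integrableOn_deriv_sq_mul hlt hψ (w := fun s => cos s ^ k) (by fun_prop)
  have hi2 : MeasureTheory.IntegrableOn (fun s => ψ s ^ 2 * cos s ^ k) (Icc (-R) R) :=
    ((hψ.continuousOn.pow 2).mul (by fun_prop)).integrableOn_Icc
  have key := intervalIntegral.sub_le_integral_of_hasDeriv_right_of_le hlt.le
    (g := fun s => v s / φ s * (ψ s ^ 2 * cos s ^ k))
    (g' := fun s => cos s ^ k * (-μ * ψ s ^ 2 - (v s / φ s) ^ 2 * ψ s ^ 2
      + 2 * (v s / φ s) * ψ s * deriv ψ s))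
    (φ := fun s => deriv ψ s ^ 2 * cos s ^ k - μ * (ψ s ^ 2 * cos s ^ k))
    ?_ ?_ (hi1.sub (hi2.const_mul μ)) ?_
  · rw [intervalIntegral.integral_sub, intervalIntegral.integral_const_mul] at key
    · simp only [hψl, hψr] at key
      linarith
    · exact (intervalIntegrable_iff_integrableOn_Icc_of_le hlt.le).2 hi1
    · exact (intervalIntegrable_iff_integrableOn_Icc_of_le hlt.le).2 (hi2.const_mul μ)
  · exact (hv.continuousOn.div hφc.continuousOn fun s hs => (hpos s hs).ne').mul
      ((hψ.continuousOn.pow 2).mul (by fun_prop))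
  · intro s hs
    have hsI := Ioo_subset_Icc_self hs
    have hφ0 := (hpos s hsI).ne'
    have hψd : HasDerivAt ψ (deriv ψ s) s :=
      ((hψ.contDiffAt (Icc_mem_nhds hs.1 hs.2)).differentiableAt one_ne_zero).hasDerivAt
    have hc := hasDerivAt_cos_pow k (cos_pos_of_mem_Icc hR hsI).ne'
    refine HasDerivAt.hasDerivWithinAt ?_
    refine (((hv' s hs).div (hφ s) hφ0).mul ((hψd.pow 2).mul hc)).congr_deriv ?_
    simp only [Pi.div_apply, Pi.mul_apply, Pi.pow_apply]
    field_simp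
    ring
  · intro s hs
    have := pow_pos (cos_pos_of_mem_Icc hR (Ioo_subset_Icc_self hs)) k
    have := mul_nonneg this.le (sq_nonneg (deriv ψ s - v s / φ s * ψ s))
    linarith

/-- The weight `cos ^ k` on `[-R, R]`, extended to the line. -/
def extWeight (k : ℕ) (R s : ℝ) : ℝ := max (cos s) (cos R) ^ k

lemma continuous_extWeight (k : ℕ) (R : ℝ) : Continuous (extWeight k R) := by
  unfold extWeight
  fun_prop

lemma extWeight_neg (k : ℕ) (R s : ℝ) : extWeight k R (-s) = extWeight k R s := by
  simp [extWeight]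

lemma extWeight_le_one (k : ℕ) {R : ℝ} (hR : 0 < cos R) (s : ℝ) : extWeight k R s ≤ 1 :=
  pow_le_one₀ (hR.le.trans (le_max_right _ _)) (max_le (cos_le_one _) (cos_le_one _))

lemma le_extWeight (k : ℕ) {R : ℝ} (hR : 0 < cos R) (s : ℝ) : cos R ^ k ≤ extWeight k R s :=
  pow_le_pow_left₀ hR.le (le_max_right _ _) k

lemma extWeight_of_mem (k : ℕ) {R s : ℝ} (hR : R < π / 2) (hs : s ∈ Icc (-R) R) :
    extWeight k R s = cos s ^ k := by
  have : cos R ≤ cos s := by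
    rw [← cos_abs s]
    have := abs_le.2 hs
    exact cos_le_cos_of_nonneg_of_le_pi (abs_nonneg s) (by linarith [pi_pos]) this
  rw [extWeight, max_eq_left this]

/-- The derivative of the even model solution with parameter `μ`. -/
def modelSlope (k : ℕ) (R μ s : ℝ) : ℝ :=
  -μ * evenSolFlux (extWeight k R) μ s / extWeight k R s

section

variable (k : ℕ) {R : ℝ} (h0 : 0 < R) (hR : R < π / 2)
include h0 hR

lemma cos_pos_right : 0 < cos R := cos_pos_of_mem_Icc hR ⟨by linarith, le_rfl⟩

lemma extWeight_pos (s : ℝ) : 0 < extWeight k R s :=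
  (pow_pos (cos_pos_right h0 hR) k).trans_le (le_extWeight k (cos_pos_right h0 hR) s)

lemma hasDerivAt_modelSol (μ s : ℝ) :
    HasDerivAt (evenSol (extWeight k R) μ) (modelSlope k R μ s) s :=
  have hc := cos_pos_right h0 hR
  hasDerivAt_evenSol (continuous_extWeight k R) (pow_pos hc k) (le_extWeight k hc)
    (extWeight_le_one k hc) (extWeight_neg k R) μ s

lemma hasDerivAt_modelFlux (μ s : ℝ) :
    HasDerivAt (evenSolFlux (extWeight k R) μ)
      (extWeight k R s * evenSol (extWeight k R) μ s) s :=
  have hc := cos_pos_right h0 hR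
  hasDerivAt_evenSolFlux (continuous_extWeight k R) (pow_pos hc k) (le_extWeight k hc)
    (extWeight_le_one k hc) (extWeight_neg k R) μ s

lemma continuous_modelSol : Continuous fun x : ℝ × ℝ => evenSol (extWeight k R) x.1 x.2 :=
  have hc := cos_pos_right h0 hR
  continuous_evenSol (continuous_extWeight k R) (pow_pos hc k) (le_extWeight k hc)
    (extWeight_le_one k hc) (extWeight_neg k R)

lemma continuous_modelSlope (μ : ℝ) : Continuous (modelSlope k R μ) := by
  have : Continuous (evenSolFlux (extWeight k R) μ) :=
    continuous_iff_continuousAt.2 fun s => (hasDerivAt_modelFlux k h0 hR μ s).continuousAt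
  exact (continuous_const.mul this).div (continuous_extWeight k R)
    fun s => (extWeight_pos k h0 hR s).ne'

lemma hasDerivAt_modelSlope (μ : ℝ) {s : ℝ} (hs : s ∈ Ioo (-R) R) :
    HasDerivAt (modelSlope k R μ)
      (k * tan s * modelSlope k R μ s - μ * evenSol (extWeight k R) μ s) s := by
  have hsI := Ioo_subset_Icc_self hs
  have hc := hasDerivAt_cos_pow k (cos_pos_of_mem_Icc hR hsI).ne'
  have hp : HasDerivAt (extWeight k R) (-(k * tan s * extWeight k R s)) s := by
    rw [extWeight_of_mem k hR hsI]
    refine hc.congr_of_eventuallyEq ?_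
    filter_upwards [Icc_mem_nhds hs.1 hs.2] with t ht
    exact extWeight_of_mem k hR ht
  have hp0 := (extWeight_pos k h0 hR s).ne'
  refine (((hasDerivAt_modelFlux k h0 hR μ s).const_mul (-μ)).div hp hp0).congr_deriv ?_
  rw [modelSlope]
  field_simp
  ring

/-- For `μ` below the first eigenvalue the Rayleigh quotient is at least `μ`. -/
lemma mul_integral_sq_le_of_modelSol_pos {μ : ℝ}
    (hpos : ∀ s ∈ Icc (-R) R, 0 < evenSol (extWeight k R) μ s) {ψ : ℝ → ℝ}
    (hψ : ContDiffOn ℝ 1 ψ (Icc (-R) R)) (hψl : ψ (-R) = 0) (hψr : ψ R = 0) :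
    μ * ∫ s in (-R)..R, ψ s ^ 2 * cos s ^ k ≤ ∫ s in (-R)..R, deriv ψ s ^ 2 * cos s ^ k :=
  mul_integral_sq_le_of_pos_solution k h0 hR (hasDerivAt_modelSol k h0 hR μ)
    (continuous_modelSlope k h0 hR μ) (fun _ => hasDerivAt_modelSlope k h0 hR μ) hpos hψ hψl hψr

lemma integral_sq_mul_cos_pow_pos {ψ : ℝ → ℝ} (hψ : ContinuousOn ψ (Icc (-R) R))
    (hne : ∃ s ∈ Icc (-R) R, ψ s ≠ 0) : 0 < ∫ s in (-R)..R, ψ s ^ 2 * cos s ^ k := by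
  refine intervalIntegral.integral_pos (by linarith) ((hψ.pow 2).mul (by fun_prop)) ?_ ?_
  · intro s hs
    have := cos_pos_of_mem_Icc hR (Ioc_subset_Icc_self hs)
    positivity
  · obtain ⟨s, hs, hs0⟩ := hne
    have := cos_pos_of_mem_Icc hR hs
    exact ⟨s, hs, by positivity⟩

lemma exists_modelSol_nonpos :
    ∃ μ, 0 ≤ μ ∧ ∃ s ∈ Icc (-R) R, evenSol (extWeight k R) μ s ≤ 0 := by
  by_contra! h
  set ψ : ℝ → ℝ := fun s => R ^ 2 - s ^ 2 with hψ
  set A := ∫ s in (-R)..R, ψ s ^ 2 * cos s ^ k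
  set B := ∫ s in (-R)..R, deriv ψ s ^ 2 * cos s ^ k
  have hψc : ContDiff ℝ 1 ψ := by fun_prop
  have hA : 0 < A := integral_sq_mul_cos_pow_pos k h0 hR hψc.continuous.continuousOn
    ⟨0, ⟨by linarith, h0.le⟩, by simp [hψ, h0.ne']⟩
  have hμ : 0 ≤ |B| / A + 1 := by positivity
  have := mul_integral_sq_le_of_modelSol_pos k h0 hR (h _ hμ) hψc.contDiffOn
    (by simp [hψ]) (by simp [hψ])
  change (|B| / A + 1) * A ≤ B at this
  rw [add_mul, div_mul_cancel₀ _ hA.ne'] at this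
  linarith [le_abs_self B]

/-- The first eigenvalue `Λ` and its even eigenfunction `φ`, decreasing away from the centre. -/
lemma exists_first_eigenfunction :
    ∃ (Λ : ℝ) (φ v : ℝ → ℝ), 0 < Λ ∧ (∀ s, HasDerivAt φ (v s) s) ∧ Continuous v ∧
      (∀ s ∈ Ioo (-R) R, HasDerivAt v (k * tan s * v s - Λ * φ s) s) ∧
      φ (-R) = 0 ∧ φ R = 0 ∧ (∀ s ∈ Ioo (-R) R, 0 < φ s) ∧
      (∀ s ∈ Ioo 0 R, v s < 0) ∧ (∀ s ∈ Ioo (-R) 0, 0 < v s) ∧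
      ∀ ψ : ℝ → ℝ, ContDiffOn ℝ 1 ψ (Icc (-R) R) → ψ (-R) = 0 → ψ R = 0 →
        Λ * ∫ s in (-R)..R, ψ s ^ 2 * cos s ^ k ≤
          ∫ s in (-R)..R, deriv ψ s ^ 2 * cos s ^ k := by
  obtain ⟨M, hM, s₁, hs₁, hMs⟩ := exists_modelSol_nonpos k h0 hR
  have hcont := continuous_modelSol k h0 hR
  obtain ⟨⟨Λ, x⟩, ⟨⟨hΛM, hx⟩, hΛx⟩, hmin⟩ :
      ∃ y ∈ (Icc 0 M ×ˢ Icc (-R) R) ∩ {y : ℝ × ℝ | evenSol (extWeight k R) y.1 y.2 ≤ 0},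
        IsMinOn Prod.fst ((Icc 0 M ×ˢ Icc (-R) R) ∩
          {y : ℝ × ℝ | evenSol (extWeight k R) y.1 y.2 ≤ 0}) y :=
    ((isCompact_Icc.prod isCompact_Icc).inter_right
      (isClosed_le hcont continuous_const)).exists_isMinOn
      ⟨(M, s₁), ⟨⟨⟨hM, le_rfl⟩, hs₁⟩, hMs⟩⟩ continuous_fst.continuousOn
  simp only [mem_ofPred_eq] at hΛM hx hΛx
  have hbelow : ∀ μ, 0 ≤ μ → μ < Λ → ∀ s ∈ Icc (-R) R, 0 < evenSol (extWeight k R) μ s := by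
    intro μ hμ hμΛ s hs
    by_contra! hle
    have := hmin (show (μ, s) ∈ _ from ⟨⟨⟨hμ, hμΛ.le.trans hΛM.2⟩, hs⟩, hle⟩)
    exact absurd this (not_le.2 hμΛ)
  have hΛ : 0 < Λ := by
    refine hΛM.1.lt_of_ne ?_
    rintro rfl
    rw [evenSol_zero_left] at hΛx
    linarith
  have hnear : ∀ᶠ μ in nhdsWithin Λ (Iio Λ), 0 ≤ μ ∧ μ < Λ := by
    filter_upwards [Ioo_mem_nhdsLT hΛ] with μ hμ using ⟨hμ.1.le, hμ.2⟩
  set φ := evenSol (extWeight k R) Λ with hφdef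
  set H := evenSolFlux (extWeight k R) Λ with hHdef
  have hφ := hasDerivAt_modelSol k h0 hR Λ
  have hH := hasDerivAt_modelFlux k h0 hR Λ
  have hφc : Continuous φ := continuous_iff_continuousAt.2 fun s => (hφ s).continuousAt
  have hwc := continuous_extWeight k R
  have hwpos := extWeight_pos k h0 hR
  have hφ0 : φ 0 = 1 := evenSol_apply_zero Λ
  have hH0 : H 0 = 0 := evenSolFlux_apply_zero Λ
  have hnonneg : ∀ s ∈ Icc (-R) R, 0 ≤ φ s := by
    intro s hs
    have ht : Filter.Tendsto (fun μ => evenSol (extWeight k R) μ s) (nhdsWithin Λ (Iio Λ))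
        (nhds (φ s)) :=
      ((hcont.comp (Continuous.prodMk_left s)).tendsto Λ).mono_left nhdsWithin_le_nhds
    refine ge_of_tendsto ht ?_
    filter_upwards [hnear] with μ hμ using (hbelow μ hμ.1 hμ.2 s hs).le
  have hHlt : ∀ a b, a < b → -R ≤ a → b ≤ R → a ≤ 0 → 0 ≤ b → 0 < H b - H a := by
    intro a b hab ha hb ha0 hb0
    rw [← intervalIntegral.integral_eq_sub_of_hasDerivAt (fun s _ => hH s)
      ((hwc.mul hφc).intervalIntegrable _ _)]
    refine intervalIntegral.integral_pos hab (hwc.mul hφc).continuousOn ?_ ⟨0, ⟨ha0, hb0⟩, ?_⟩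
    · intro s hs
      exact mul_nonneg (hwpos s).le (hnonneg s ⟨by linarith [hs.1], by linarith [hs.2]⟩)
    · rw [← hφdef, hφ0, mul_one]
      exact hwpos 0
  have hvneg : ∀ s, 0 < s → s ≤ R → modelSlope k R Λ s < 0 := by
    intro s hs hsR
    have := hHlt 0 s hs (by linarith) hsR le_rfl hs.le
    rw [hH0, sub_zero] at this
    exact div_neg_of_neg_of_pos (by rw [← hHdef]; nlinarith) (hwpos s)
  have hvpos : ∀ s, s < 0 → -R ≤ s → 0 < modelSlope k R Λ s := by
    intro s hs hsR
    have := hHlt s 0 hs hsR h0.le hs.le le_rfl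
    rw [hH0, zero_sub] at this
    exact div_pos (by rw [← hHdef]; nlinarith) (hwpos s)
  have hanti : StrictAntiOn φ (Icc 0 R) := by
    refine strictAntiOn_of_deriv_neg (convex_Icc 0 R) hφc.continuousOn fun s hs => ?_
    rw [interior_Icc] at hs
    rw [(hφ s).deriv]
    exact hvneg s hs.1 hs.2.le
  have heven : ∀ s, φ |s| = φ s := by
    intro s
    rcases abs_choice s with h | h <;> rw [h]
    exact evenSol_neg (extWeight_neg k R) Λ s
  have hRnonneg : 0 ≤ φ R := hnonneg R ⟨by linarith, le_rfl⟩
  have hpos : ∀ s ∈ Ioo (-R) R, 0 < φ s := by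
    intro s hs
    have hs' := abs_lt.2 hs
    rw [← heven s]
    exact hRnonneg.trans_lt (hanti ⟨abs_nonneg s, hs'.le⟩ ⟨h0.le, le_rfl⟩ hs')
  have hφR : φ R = 0 := by
    refine le_antisymm ?_ hRnonneg
    rcases (abs_le.2 hx).lt_or_eq with h | h
    · exact absurd (hpos x (abs_lt.1 h)) (not_lt.2 hΛx)
    · rw [← h, heven]
      exact hΛx
  refine ⟨Λ, φ, modelSlope k R Λ, hΛ, hφ, continuous_modelSlope k h0 hR Λ,
    fun _ => hasDerivAt_modelSlope k h0 hR Λ, ?_, hφR, hpos,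
    fun s hs => hvneg s hs.1 hs.2.le, fun s hs => hvpos s hs.2 hs.1.le, ?_⟩
  · rw [hφdef, evenSol_neg (extWeight_neg k R)]
    exact hφR
  · intro ψ hψ hl hr
    have ht : Filter.Tendsto (fun μ => μ * ∫ s in (-R)..R, ψ s ^ 2 * cos s ^ k)
        (nhdsWithin Λ (Iio Λ)) (nhds (Λ * ∫ s in (-R)..R, ψ s ^ 2 * cos s ^ k)) :=
      ((continuous_mul_const _).tendsto Λ).mono_left nhdsWithin_le_nhds
    refine le_of_tendsto ht ?_
    filter_upwards [hnear] with μ hμ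
    exact mul_integral_sq_le_of_modelSol_pos k h0 hR (hbelow μ hμ.1 hμ.2) hψ hl hr

end

end Sturm

section Comparison

lemma tan_div_lt_mul_tan {ρ s : ℝ} (hρ : 1 < ρ) (hs : 0 < s) (hs' : s < π / 2) :
    tan (s / ρ) < ρ * tan s := by
  have h1 : s / ρ < s := div_lt_self hs hρ
  have h2 : tan (s / ρ) < tan s :=
    tan_lt_tan_of_nonneg_of_lt_pi_div_two (by positivity) hs' h1
  have h3 : 0 < tan s := tan_pos_of_pos_of_lt_pi_div_two hs hs'
  nlinarith

/-- A dilated first eigenfunction has dilated Rayleigh quotient strictly below the eigenvalue. -/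
lemma integral_dilated_slope_sq_lt {k : ℕ} (hk : k ≠ 0) {R ρ Λ : ℝ} (h0 : 0 < R) (hρ : 1 < ρ)
    (hR : ρ * R < π / 2) {φ v : ℝ → ℝ} (hφ : ∀ s, HasDerivAt φ (v s) s) (hv : Continuous v)
    (hv' : ∀ s ∈ Ioo (-R) R, HasDerivAt v (k * tan s * v s - Λ * φ s) s)
    (hl : φ (-R) = 0) (hr : φ R = 0) (hpos : ∀ s ∈ Ioo (-R) R, 0 < φ s)
    (hvr : ∀ s ∈ Ioo 0 R, v s < 0) (hvl : ∀ s ∈ Ioo (-R) 0, 0 < v s) :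
    ∫ s in (-(ρ * R))..(ρ * R), v (s / ρ) ^ 2 * cos s ^ k <
      Λ * ∫ s in (-(ρ * R))..(ρ * R), φ (s / ρ) ^ 2 * cos s ^ k := by
  have hρ0 : 0 < ρ := by linarith
  have hρR : 0 < ρ * R := by positivity
  have hφc : Continuous φ := continuous_iff_continuousAt.2 fun s => (hφ s).continuousAt
  have hmem : ∀ {s}, s ∈ Ioo (-(ρ * R)) (ρ * R) → s / ρ ∈ Ioo (-R) R := by
    intro s hs
    rw [mem_Ioo, lt_div_iff₀ hρ0, div_lt_iff₀ hρ0]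
    constructor <;> linarith [hs.1, hs.2]
  have hcos : ∀ s ∈ Icc (-(ρ * R)) (ρ * R), 0 < cos s := fun s hs => cos_pos_of_mem_Icc hR hs
  have hcos' : ∀ s ∈ Icc (-(ρ * R)) (ρ * R), 0 < cos (s / ρ) := by
    intro s hs
    refine cos_pos_of_mem_Icc (R := R) (by nlinarith) ⟨?_, ?_⟩
    · rw [le_div_iff₀ hρ0]; linarith [hs.1]
    · rw [div_le_iff₀ hρ0]; linarith [hs.2]
  set B : ℝ → ℝ := fun s =>
    k * (φ (s / ρ) * v (s / ρ) * cos s ^ k * (tan (s / ρ) - ρ * tan s)) with hB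
  have htan : ContinuousOn tan (Icc (-(ρ * R)) (ρ * R)) := fun s hs =>
    (continuousAt_tan.2 (hcos s hs).ne').continuousWithinAt
  have htan' : ContinuousOn (fun s => tan (s / ρ)) (Icc (-(ρ * R)) (ρ * R)) := fun s hs =>
    ((continuousAt_tan.2 (hcos' s hs).ne').comp
      (f := fun s : ℝ => s / ρ) (by fun_prop)).continuousWithinAt
  have hBc : ContinuousOn B (Icc (-(ρ * R)) (ρ * R)) := by
    refine continuousOn_const.mul (ContinuousOn.mul ?_ (htan'.sub (continuousOn_const.mul htan)))
    fun_prop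
  have hk0 : (0 : ℝ) < k := by exact_mod_cast Nat.pos_of_ne_zero hk
  have hBpos : ∀ s ∈ Ioo (-(ρ * R)) (ρ * R), s ≠ 0 → 0 < B s := by
    intro s hs hs0
    have hc := pow_pos (hcos s (Ioo_subset_Icc_self hs)) k
    have hp := hpos _ (hmem hs)
    have hm := hmem hs
    refine mul_pos hk0 ?_
    rcases hs0.lt_or_gt with h | h
    · have h1 := hvl (s / ρ) ⟨hm.1, div_neg_of_neg_of_pos h hρ0⟩
      have h2 := tan_div_lt_mul_tan hρ (neg_pos.2 h) (by linarith [hs.1])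
      rw [neg_div, tan_neg, tan_neg] at h2
      exact mul_pos (mul_pos (mul_pos hp h1) hc) (by linarith)
    · have h1 := hvr (s / ρ) ⟨div_pos h hρ0, hm.2⟩
      have h2 := tan_div_lt_mul_tan hρ h (by linarith [hs.2])
      exact mul_pos_of_neg_of_neg (mul_neg_of_neg_of_pos (mul_neg_of_pos_of_neg hp h1) hc)
        (by linarith)
  have hBint : 0 < ∫ s in (-(ρ * R))..(ρ * R), B s := by
    refine intervalIntegral.integral_pos (by linarith) hBc ?_ ⟨ρ * R / 2, ?_, ?_⟩
    · intro s hs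
      rcases hs.2.lt_or_eq with h | h
      · by_cases hs0 : s = 0
        · simp [hB, hs0]
        · exact (hBpos s ⟨hs.1, h⟩ hs0).le
      · simp [hB, h, hρ0.ne', hr]
    · constructor <;> linarith
    · exact hBpos _ ⟨by linarith, by linarith⟩ (by positivity)
  have hi1 : IntervalIntegrable (fun s => v (s / ρ) ^ 2 * cos s ^ k) MeasureTheory.volume
      (-(ρ * R)) (ρ * R) := Continuous.intervalIntegrable (by fun_prop) _ _
  have hi2 : IntervalIntegrable (fun s => Λ * (φ (s / ρ) ^ 2 * cos s ^ k)) MeasureTheory.volume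
      (-(ρ * R)) (ρ * R) := Continuous.intervalIntegrable (by fun_prop) _ _
  have hi3 : IntervalIntegrable B MeasureTheory.volume (-(ρ * R)) (ρ * R) :=
    (hBc.mono (by rw [uIcc_of_le (by linarith)])).intervalIntegrable
  have key := intervalIntegral.integral_eq_sub_of_hasDerivAt_of_le (a := -(ρ * R)) (b := ρ * R)
    (f := fun s => ρ * (φ (s / ρ) * v (s / ρ) * cos s ^ k))
    (f' := fun s => v (s / ρ) ^ 2 * cos s ^ k - Λ * (φ (s / ρ) ^ 2 * cos s ^ k) + B s)
    (by linarith) (by fun_prop) ?_ ((hi1.sub hi2).add hi3)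
  · rw [intervalIntegral.integral_add (hi1.sub hi2) hi3, intervalIntegral.integral_sub hi1 hi2,
      intervalIntegral.integral_const_mul, neg_div, mul_div_cancel_left₀ _ hρ0.ne', hl, hr] at key
    linarith
  · intro s hs
    have hdiv : HasDerivAt (fun s => s / ρ) (1 / ρ) s := (hasDerivAt_id s).div_const ρ
    have h1 : HasDerivAt (fun s => φ (s / ρ)) _ s := (hφ (s / ρ)).comp s hdiv
    have h2 : HasDerivAt (fun s => v (s / ρ)) _ s := (hv' _ (hmem hs)).comp s hdiv
    have h3 := hasDerivAt_cos_pow k (hcos s (Ioo_subset_Icc_self hs)).ne'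
    refine (((h1.mul h2).mul h3).const_mul ρ).congr_deriv ?_
    simp only [hB, Pi.mul_apply]
    field_simp
    ring

end Comparison

/-- For `n ≥ 2`, `D²·λ̄₁(n,D)` is strictly decreasing in `D` on `(0, π)`. -/
theorem modelLam1_normalized_strictAnti (n : ℕ) (hn : 2 ≤ n) (D₁ D₂ : ℝ)
    (h1 : 0 < D₁) (h12 : D₁ < D₂) (h2 : D₂ < π) :
    D₁ ^ 2 * modelLam1 n D₁ > D₂ ^ 2 * modelLam1 n D₂ := by
  have h0 : 0 < D₁ / 2 := by linarith
  have hD₂ : 0 < D₂ := h1.trans h12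
  have h0' : 0 < D₂ / 2 := by linarith
  have hR' : D₂ / 2 < π / 2 := by linarith
  obtain ⟨Λ, φ, v, hΛ, hφ, hv, hv', hl, hr, hpos, hvr, hvl, hlow⟩ :=
    exists_first_eigenfunction (n - 1) h0 (by linarith : D₁ / 2 < π / 2)
  have hρ : 1 < D₂ / D₁ := (one_lt_div h1).2 h12
  have hρ0 : D₂ / D₁ ≠ 0 := by positivity
  have hρR : D₂ / D₁ * (D₁ / 2) = D₂ / 2 := by field_simp
  have hφ1 : ContDiff ℝ 1 φ := by
    rw [contDiff_one_iff_deriv]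
    exact ⟨fun s => (hφ s).differentiableAt, by rwa [funext fun s => (hφ s).deriv]⟩
  have hD1 : Λ ≤ modelLam1 n D₁ := by
    refine le_csInf (Set.Nonempty.image _ ⟨φ, hφ1.contDiffOn, ⟨0, ?_, ?_⟩, hl, hr⟩) ?_
    · constructor <;> linarith
    · exact (hpos 0 ⟨by linarith, h0⟩).ne'
    · rintro _ ⟨ψ, ⟨hψ, hne, hψl, hψr⟩, rfl⟩
      rw [rayleighQ, le_div_iff₀ (integral_sq_mul_cos_pow_pos (n - 1) h0 (by linarith)
        hψ.continuousOn hne)]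
      exact hlow ψ hψ hψl hψr
  have hlt := integral_dilated_slope_sq_lt (k := n - 1) (by omega) h0 hρ (by rwa [hρR])
    hφ hv hv' hl hr hpos hvr hvl
  rw [hρR] at hlt
  set Φ : ℝ → ℝ := fun s => φ (s / (D₂ / D₁)) with hΦ
  have hΦd : ∀ s, deriv Φ s = v (s / (D₂ / D₁)) * (1 / (D₂ / D₁)) := fun s =>
    ((hφ _).comp s ((hasDerivAt_id s).div_const (D₂ / D₁))).deriv
  have hend : D₂ / 2 / (D₂ / D₁) = D₁ / 2 := by field_simp
  have hΦ1 : ContDiff ℝ 1 Φ := hφ1.comp (by fun_prop)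
  have hΦne : ∃ s ∈ Icc (-(D₂ / 2)) (D₂ / 2), Φ s ≠ 0 :=
    ⟨0, ⟨by linarith, h0'.le⟩, by simpa [hΦ] using (hpos 0 ⟨by linarith, h0⟩).ne'⟩
  have hden := integral_sq_mul_cos_pow_pos (n - 1) h0' hR' hΦ1.continuous.continuousOn hΦne
  have hD2 : modelLam1 n D₂ ≤ rayleighQ n D₂ Φ := by
    refine csInf_le ⟨0, ?_⟩ ⟨Φ, ⟨hΦ1.contDiffOn, hΦne, ?_, ?_⟩, rfl⟩
    · rintro _ ⟨ψ, -, rfl⟩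
      refine div_nonneg ?_ ?_ <;>
      · refine intervalIntegral.integral_nonneg (by linarith) fun s hs => ?_
        have := cos_pos_of_mem_Icc hR' hs
        positivity
    · simpa [hΦ, neg_div, hend] using hl
    · simpa [hΦ, hend] using hr
  have hQ : D₂ ^ 2 * rayleighQ n D₂ Φ < D₁ ^ 2 * Λ := by
    have hnum : ∫ s in (-(D₂ / 2))..(D₂ / 2), deriv Φ s ^ 2 * cos s ^ (n - 1) =
        (D₁ / D₂) ^ 2 * ∫ s in (-(D₂ / 2))..(D₂ / 2),
          v (s / (D₂ / D₁)) ^ 2 * cos s ^ (n - 1) := by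
      rw [← intervalIntegral.integral_const_mul]
      congr 1; ext s
      rw [hΦd, one_div_div]
      ring
    rw [rayleighQ, hnum, ← mul_div_assoc, div_lt_iff₀ hden, ← mul_assoc, ← mul_pow,
      mul_div_cancel₀ _ hD₂.ne', mul_assoc]
    exact mul_lt_mul_of_pos_left hlt (by positivity)
  calc D₂ ^ 2 * modelLam1 n D₂ ≤ D₂ ^ 2 * rayleighQ n D₂ Φ := by gcongr
    _ < D₁ ^ 2 * Λ := hQ
    _ ≤ D₁ ^ 2 * modelLam1 n D₁ := by gcongr
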